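/- Let r1, r2, r3, r4 be real numbers and write ri* = 1 + r1 − ri for i = 2,3,4. Assume that none of r2*, r3*, r4*, 1 + r1/2, and 1 + r1 is a nonpositive integer, that 1 + r1 − r3 − r4 > 0, and that 3 + 2·r1 − 2·(r2 + r3 + r4) > 0 (so that both series below converge absolutely). Then the well-poised hypergeometric series satisfies Whipple's reduction formula: 4F3(r1, r2, r3, r4; r2*, r3*, r4*; −1) = [Γ(r3*)·Γ(r4*) / (Γ(1 + r1)·Γ(r4* − r3))] · 3F2(1 + r1/2 − r2, r3, r4; 1 + r1/2, r2*; 1). -/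

import Mathlib

open Real

/-- Ascending Pochhammer symbol `(x)_k = x(x+1)⋯(x+k−1)`. -/
noncomputable def poch (x : ℝ) (k : ℕ) : ℝ := (ascPochhammer ℝ k).eval x

/-- Generalized hypergeometric series `₄F₃(a₁,a₂,a₃,a₄; b₁,b₂,b₃; z)`. -/
noncomputable def F43 (a1 a2 a3 a4 b1 b2 b3 z : ℝ) : ℝ :=
  ∑' k : ℕ, (poch a1 k * poch a2 k * poch a3 k * poch a4 k)
      / (poch b1 k * poch b2 k * poch b3 k * (k.factorial : ℝ)) * z ^ k

/-- Generalized hypergeometric series `₃F₂(a₁,a₂,a₃; b₁,b₂; z)`. -/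
noncomputable def F32 (a1 a2 a3 b1 b2 z : ℝ) : ℝ :=
  ∑' k : ℕ, (poch a1 k * poch a2 k * poch a3 k)
      / (poch b1 k * poch b2 k * (k.factorial : ℝ)) * z ^ k

open Filter Topology

theorem poch_zero (x : ℝ) : poch x 0 = 1 := by simp [poch]

theorem poch_succ (x : ℝ) (k : ℕ) : poch x (k + 1) = poch x k * (x + k) := by
  simp [poch, ascPochhammer_succ_eval]

theorem poch_add (x : ℝ) (m n : ℕ) : poch x (m + n) = poch x m * poch (x + m) n := by
  induction n with
  | zero => simp [poch_zero]
  | succ n ih =>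
    rw [← add_assoc, poch_succ, ih, poch_succ]
    push_cast
    ring

theorem poch_ne_zero {x : ℝ} (hx : ∀ n : ℕ, x ≠ -(n : ℝ)) (k : ℕ) : poch x k ≠ 0 := by
  induction k with
  | zero => simp [poch_zero]
  | succ k ih =>
    rw [poch_succ]
    exact mul_ne_zero ih fun h => hx k (eq_neg_of_add_eq_zero_left h)

theorem poch_pos {x : ℝ} (hx : 0 < x) (k : ℕ) : 0 < poch x k := ascPochhammer_pos k x hx

theorem poch_mono {x y : ℝ} (hx : 0 < x) (hxy : x ≤ y) (k : ℕ) : poch x k ≤ poch y k := by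
  induction k with
  | zero => simp [poch_zero]
  | succ k ih =>
    rw [poch_succ, poch_succ]
    have := (poch_pos hx k).le
    have := (poch_pos (hx.trans_le hxy) k).le
    gcongr

theorem le_poch_succ {x : ℝ} (hx : 1 ≤ x) (k : ℕ) : x ≤ poch x (k + 1) := by
  have hx0 : 0 < x := by linarith
  induction k with
  | zero => simp [poch_succ, poch_zero]
  | succ k ih =>
    rw [poch_succ]
    have h1 : 1 ≤ x + ((k + 1 : ℕ) : ℝ) := by
      have : (0 : ℝ) ≤ ((k + 1 : ℕ) : ℝ) := by positivity
      linarith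
    exact ih.trans (le_mul_of_one_le_right (poch_pos hx0 _).le h1)

theorem ne_neg_nat_add {x : ℝ} (hx : ∀ n : ℕ, x ≠ -(n : ℝ)) (k : ℕ) (n : ℕ) :
    x + k ≠ -(n : ℝ) := by
  intro h
  apply hx (k + n)
  push_cast
  linarith

theorem Gamma_add_nat {x : ℝ} (hx : ∀ n : ℕ, x ≠ -(n : ℝ)) (k : ℕ) :
    Gamma (x + k) = poch x k * Gamma x := by
  induction k with
  | zero => simp [poch_zero]
  | succ k ih =>
    have h : x + k ≠ 0 := fun h => hx k (eq_neg_of_add_eq_zero_left h)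
    push_cast
    rw [← add_assoc, Gamma_add_one h, ih, poch_succ]
    ring

theorem prod_range_eq_poch (x : ℝ) (n : ℕ) : ∏ j ∈ Finset.range n, (x + j) = poch x n := by
  induction n with
  | zero => simp [poch_zero]
  | succ n ih => rw [Finset.prod_range_succ, ih, poch_succ]

/-- The Pochhammer symbol `(x)_k` is asymptotic to `k! k ^ (x - 1) / Γ(x)`; at the poles of `Γ`
the limit is `0`. -/
theorem tendsto_poch_div (x : ℝ) :
    Tendsto (fun k : ℕ => poch x k / (k.factorial * (k : ℝ) ^ (x - 1))) atTop
      (𝓝 (Gamma x)⁻¹) := by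
  by_cases hx : ∀ n : ℕ, x ≠ -(n : ℝ)
  · have h1 : Tendsto (fun k : ℕ => (k : ℝ) / (k + x)) atTop (𝓝 1) :=
      tendsto_natCast_div_add_atTop x
    have h2 := h1.mul ((GammaSeq_tendsto_Gamma x).inv₀ (Gamma_ne_zero hx))
    rw [one_mul] at h2
    refine h2.congr' ?_
    filter_upwards [eventually_ge_atTop 1] with k hk
    have hk0 : (0 : ℝ) < k := by exact_mod_cast hk
    have hxk : x + k ≠ 0 := fun h => hx k (eq_neg_of_add_eq_zero_left h)
    have hp := poch_ne_zero hx k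
    have hf : (k.factorial : ℝ) ≠ 0 := by positivity
    have hr : (k : ℝ) ^ x ≠ 0 := by positivity
    rw [GammaSeq, prod_range_eq_poch, poch_succ, rpow_sub hk0, rpow_one, add_comm (k : ℝ) x]
    field_simp
  · push Not at hx
    obtain ⟨n, hn⟩ := hx
    rw [hn, Gamma_neg_nat_eq_zero, inv_zero]
    refine tendsto_const_nhds.congr' ?_
    filter_upwards [eventually_ge_atTop (n + 1)] with k hk
    obtain ⟨m, rfl⟩ := Nat.exists_eq_add_of_le hk
    rw [poch_add, poch_succ]
    simp

theorem summable_of_tendsto_mul_rpow {u : ℕ → ℝ} {p L : ℝ} (hp : 1 < p)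
    (h : Tendsto (fun k : ℕ => u k * (k : ℝ) ^ p) atTop (𝓝 L)) : Summable u := by
  have hs : Summable fun k : ℕ => (k : ℝ) ^ (-p) := Real.summable_nat_rpow.2 (by linarith)
  refine summable_of_isBigO_nat hs ?_
  have h1 := (h.isBigO_one ℝ).mul (Asymptotics.isBigO_refl (fun k : ℕ => (k : ℝ) ^ (-p)) atTop)
  refine h1.congr' ?_ ?_
  · filter_upwards [eventually_ge_atTop 1] with k hk
    have hk0 : (0 : ℝ) < k := by exact_mod_cast hk
    rw [mul_assoc, ← rpow_add hk0]
    simp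
  · exact Eventually.of_forall fun k => by simp

/-- The general term of `₂F₁(a, b; c; 1)`. -/
noncomputable def gaussTerm (a b c : ℝ) (k : ℕ) : ℝ :=
  poch a k * poch b k / (poch c k * k.factorial)

theorem tendsto_gaussTerm_mul_rpow (a b : ℝ) {c : ℝ} (hc : ∀ n : ℕ, c ≠ -(n : ℝ)) :
    Tendsto (fun k : ℕ => gaussTerm a b c k * (k : ℝ) ^ (1 + (c - a - b))) atTop
      (𝓝 ((Gamma a)⁻¹ * (Gamma b)⁻¹ / (Gamma c)⁻¹)) := by
  refine (((tendsto_poch_div a).mul (tendsto_poch_div b)).div (tendsto_poch_div c)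
    (inv_ne_zero (Gamma_ne_zero hc))).congr' ?_
  filter_upwards [eventually_ge_atTop 1] with k hk
  have hk0 : (0 : ℝ) < k := by exact_mod_cast hk
  have hp := poch_ne_zero hc k
  have hf : (k.factorial : ℝ) ≠ 0 := by positivity
  have h1 : (k : ℝ) ^ (c - 1)
      = k ^ (a - 1) * k ^ (b - 1) * k ^ (1 + (c - a - b)) := by
    rw [← rpow_add hk0, ← rpow_add hk0]
    ring_nf
  simp only [Pi.div_apply]
  rw [gaussTerm, h1]
  field_simp

theorem summable_gaussTerm {a b c : ℝ} (hc : ∀ n : ℕ, c ≠ -(n : ℝ)) (h : 0 < c - a - b) :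
    Summable (gaussTerm a b c) :=
  summable_of_tendsto_mul_rpow (by linarith) (tendsto_gaussTerm_mul_rpow a b hc)

theorem tsum_gaussTerm_contiguous {a b c : ℝ} (hc : ∀ n : ℕ, c ≠ -(n : ℝ))
    (h : 0 < c - a - b) :
    c * (c - a - b) * ∑' k, gaussTerm a b c k
      = (c - a) * (c - b) * ∑' k, gaussTerm a b (c + 1) k := by
  have hc1 : ∀ n : ℕ, c + 1 ≠ -(n : ℝ) := by simpa using ne_neg_nat_add hc 1
  have hs := summable_gaussTerm hc h
  have hs1 := summable_gaussTerm (a := a) (b := b) hc1 (by linarith)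
  have hG : Tendsto (fun k : ℕ => -(c * (k * gaussTerm a b c k))) atTop (𝓝 0) := by
    have h1 := (tendsto_gaussTerm_mul_rpow a b hc).mul
      ((tendsto_rpow_neg_atTop h).comp tendsto_natCast_atTop_atTop)
    rw [mul_zero] at h1
    have h2 := (h1.const_mul c).neg
    rw [mul_zero, neg_zero] at h2
    refine h2.congr' ?_
    filter_upwards [eventually_ge_atTop 1] with k hk
    have hk0 : (0 : ℝ) < k := by exact_mod_cast hk
    simp only [Function.comp_apply]
    rw [mul_assoc (gaussTerm a b c k), ← rpow_add hk0, add_neg_cancel_right, rpow_one]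
    ring
  have key : ∀ k : ℕ, c * (c - a - b) * gaussTerm a b c k
      - (c - a) * (c - b) * gaussTerm a b (c + 1) k
      = -(c * ((k + 1 : ℕ) * gaussTerm a b c (k + 1))) - -(c * (k * gaussTerm a b c k)) := by
    intro k
    have hp := poch_ne_zero hc k
    have hck : c + k ≠ 0 := fun h => hc k (eq_neg_of_add_eq_zero_left h)
    have hc0 : c ≠ 0 := by simpa using hc 0
    have hf : (k.factorial : ℝ) ≠ 0 := by positivity
    have h1 : poch (c + 1) k = poch c k * (c + k) / c := by
      have := poch_add c 1 k
      rw [add_comm 1 k, poch_succ] at this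
      rw [this, show (1 : ℕ) = 0 + 1 from rfl, poch_succ, poch_zero]
      push_cast
      field_simp
      ring_nf
    have hk1 : (k + 1 : ℝ) ≠ 0 := by positivity
    simp only [gaussTerm, h1, poch_succ, Nat.factorial_succ]
    push_cast
    field_simp
    ring
  have h1 := (hs.mul_left (c * (c - a - b))).hasSum.sub
    (hs1.mul_left ((c - a) * (c - b))).hasSum
  have h2 := h1.tendsto_sum_nat
  simp only [key, Finset.sum_range_sub (fun k : ℕ => -(c * (k * gaussTerm a b c k)))] at h2
  have h3 := tendsto_nhds_unique h2 (hG.sub_const _)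
  simp only [tsum_mul_left, Nat.cast_zero, zero_mul, mul_zero, neg_zero, sub_zero] at h3
  linarith

theorem tsum_gaussTerm_eq_mul_shift {a b c : ℝ} (hc : ∀ n : ℕ, c ≠ -(n : ℝ))
    (h : 0 < c - a - b) (n : ℕ) :
    ∑' k, gaussTerm a b c k = poch (c - a) n * poch (c - b) n / (poch c n * poch (c - a - b) n)
      * ∑' k, gaussTerm a b (c + n) k := by
  induction n with
  | zero => simp [poch_zero]
  | succ n ih =>
    have h1 := tsum_gaussTerm_contiguous (a := a) (b := b) (ne_neg_nat_add hc n)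
      (by have : (0 : ℝ) ≤ n := n.cast_nonneg
          linarith)
    have hp := poch_ne_zero hc n
    have hp1 := (poch_pos h n).ne'
    have hcn : c + n ≠ 0 := fun h => hc n (eq_neg_of_add_eq_zero_left h)
    have hcn1 : c - a - b + n ≠ 0 := by positivity
    rw [ih, poch_succ, poch_succ, poch_succ, poch_succ]
    push_cast
    rw [← add_assoc]
    field_simp
    linear_combination (poch (c - a) n * poch (c - b) n) * h1

theorem tendsto_tsum_gaussTerm_add_nat (a b c : ℝ) :
    Tendsto (fun n : ℕ => ∑' k, gaussTerm a b (c + n) k) atTop (𝓝 1) := by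
  obtain ⟨N, hN⟩ := exists_nat_gt (max (-c) (a + b - c))
  have hN1 : 0 < c + N := by linarith [le_max_left (-c) (a + b - c)]
  have hN2 : 0 < c + N - a - b := by linarith [le_max_right (-c) (a + b - c)]
  have hcN : ∀ n : ℕ, c + N ≠ -(n : ℝ) := fun n hn => by
    have : (0 : ℝ) ≤ n := n.cast_nonneg
    linarith
  have hlim : ∑' k, (if k = 0 then (1 : ℝ) else 0) = 1 := by simp
  rw [← hlim]
  refine tendsto_tsum_of_dominated_convergence (summable_gaussTerm hcN hN2).norm ?_ ?_
  · intro k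
    cases k with
    | zero => simp [gaussTerm, poch_zero]
    | succ k =>
      have hcast : Tendsto (fun n : ℕ => c + (n : ℝ)) atTop atTop :=
        tendsto_atTop_add_const_left _ _ tendsto_natCast_atTop_atTop
      have h1 : Tendsto (fun n : ℕ => poch (c + n) (k + 1)) atTop atTop := by
        refine tendsto_atTop_mono' _ ?_ hcast
        filter_upwards [hcast.eventually_ge_atTop 1] with n hn
        exact le_poch_succ hn k
      have h2 : Tendsto (fun n : ℕ => poch (c + n) (k + 1) * (k + 1).factorial) atTop atTop :=
        h1.atTop_mul_const (by positivity)
      simpa [gaussTerm] using h2.const_div_atTop (poch a (k + 1) * poch b (k + 1))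
  · filter_upwards [eventually_ge_atTop N] with n hn k
    have hn' : (N : ℝ) ≤ n := by exact_mod_cast hn
    have h1 := poch_pos hN1 k
    have h2 : poch (c + N) k ≤ poch (c + n) k := poch_mono hN1 (by linarith) k
    have h3 : 0 < poch (c + n) k := h1.trans_le h2
    simp only [gaussTerm, norm_div, norm_mul, norm_natCast, norm_of_nonneg h1.le,
      norm_of_nonneg h3.le]
    gcongr

/-- Gauss's summation theorem for `₂F₁(a, b; c; 1)`. -/
theorem tsum_gaussTerm {a b c : ℝ} (hc : ∀ n : ℕ, c ≠ -(n : ℝ)) (h : 0 < c - a - b) :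
    ∑' k, gaussTerm a b c k
      = Gamma c * Gamma (c - a - b) / (Gamma (c - a) * Gamma (c - b)) := by
  have hP : Tendsto (fun n : ℕ => poch (c - a) n * poch (c - b) n
      / (poch c n * poch (c - a - b) n)) atTop
      (𝓝 ((Gamma (c - a))⁻¹ * (Gamma (c - b))⁻¹
        / ((Gamma c)⁻¹ * (Gamma (c - a - b))⁻¹))) := by
    refine (((tendsto_poch_div (c - a)).mul (tendsto_poch_div (c - b))).div
      ((tendsto_poch_div c).mul (tendsto_poch_div (c - a - b)))
      (mul_ne_zero (inv_ne_zero (Gamma_ne_zero hc))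
        (inv_ne_zero (Gamma_pos_of_pos h).ne'))).congr' ?_
    filter_upwards [eventually_ge_atTop 1] with k hk
    have hk0 : (0 : ℝ) < k := by exact_mod_cast hk
    have hp := poch_ne_zero hc k
    have hp1 := (poch_pos h k).ne'
    have hf : (k.factorial : ℝ) ≠ 0 := by positivity
    have h1 : (k : ℝ) ^ (c - 1) * k ^ (c - a - b - 1)
        = k ^ (c - a - 1) * k ^ (c - b - 1) := by
      rw [← rpow_add hk0, ← rpow_add hk0]
      ring_nf
    have e1 : (k : ℝ) ^ (c - 1) ≠ 0 := by positivity
    have e2 : (k : ℝ) ^ (c - a - b - 1) ≠ 0 := by positivity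
    have e3 : (k : ℝ) ^ (c - a - 1) ≠ 0 := by positivity
    have e4 : (k : ℝ) ^ (c - b - 1) ≠ 0 := by positivity
    simp only [Pi.div_apply]
    field_simp
    linear_combination (poch (c - a) k * poch (c - b) k) * h1
  have h1 := hP.mul (tendsto_tsum_gaussTerm_add_nat a b c)
  simp only [← tsum_gaussTerm_eq_mul_shift hc h] at h1
  rw [tendsto_nhds_unique tendsto_const_nhds h1]
  simp only [div_eq_mul_inv, mul_inv, inv_inv, mul_one]
  ring

/-- Dixon's theorem for the terminating well-poised `₃F₂(a, b, -n; 1 + a - b, 1 + a + n; 1)`,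
divided by `n! (1 + a)_n`. -/
theorem sum_choose_poch_eq {a b : ℝ} (hab : ∀ n : ℕ, 1 + a - b ≠ -(n : ℝ))
    (ha2 : ∀ n : ℕ, 1 + a / 2 ≠ -(n : ℝ)) (ha : ∀ n : ℕ, 1 + a ≠ -(n : ℝ)) (n : ℕ) :
    ∑ k ∈ Finset.range (n + 1), (-1) ^ k * poch a k * poch b k * (n.choose k : ℝ)
        / (n.factorial * poch (1 + a - b) k * poch (1 + a) (n + k))
      = poch (1 + a / 2 - b) n
        / (n.factorial * poch (1 + a / 2) n * poch (1 + a - b) n) := by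
  induction n with
  | zero => simp [poch_zero]
  | succ n ih =>
    set f : ℕ → ℕ → ℝ := fun n k => (-1) ^ k * poch a k * poch b k * (n.choose k : ℝ)
        / (n.factorial * poch (1 + a - b) k * poch (1 + a) (n + k)) with hf
    set g : ℕ → ℝ := fun k => -(1 / 2) * ((-1) ^ k * poch a k * poch b k
        * ((n + 1).choose k : ℝ) * k * (a - b + k)
        / ((n + 1).factorial * poch (1 + a - b) k * poch (1 + a) (n + k))) with hg
    have key : ∀ k, (n + 1) * (1 + a / 2 + n) * (1 + a - b + n) * f (n + 1) k
        - (1 + a / 2 - b + n) * f n k = g (k + 1) - g k := by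
      intro k
      have c1 : ((n.choose k : ℕ) : ℝ) = (n + 1).choose k * (n + 1 - k) / (n + 1) := by
        rw [eq_div_iff (by positivity)]
        rcases le_or_gt k (n + 1) with hk | hk
        · have := Nat.choose_mul_succ_eq n k
          rw [← @Nat.cast_inj ℝ] at this
          push_cast [Nat.cast_sub hk] at this
          linarith
        · simp [Nat.choose_eq_zero_of_lt hk, Nat.choose_eq_zero_of_lt (by omega : n < k)]
      have c2 : (((n + 1).choose (k + 1) : ℕ) : ℝ)
          = (n + 1).choose k * (n + 1 - k) / (k + 1) := by
        rw [eq_div_iff (by positivity)]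
        rcases le_or_gt k (n + 1) with hk | hk
        · have := Nat.choose_succ_right_eq (n + 1) k
          rw [← @Nat.cast_inj ℝ] at this
          push_cast [Nat.cast_sub hk] at this
          linarith
        · simp [Nat.choose_eq_zero_of_lt hk, Nat.choose_eq_zero_of_lt (by omega : n + 1 < k + 1)]
      have p1 := poch_ne_zero hab k
      have p2 := poch_ne_zero ha (n + k)
      have p3 : 1 + a - b + k ≠ 0 := fun h => hab k (eq_neg_of_add_eq_zero_left h)
      have p4 : 1 + a + (n + k) ≠ 0 := fun h => ha (n + k) (by push_cast; linarith)
      have hfac : (n.factorial : ℝ) ≠ 0 := by positivity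
      have hn1 : (n + 1 : ℝ) ≠ 0 := by positivity
      have hk1 : (k + 1 : ℝ) ≠ 0 := by positivity
      simp only [hf, hg, c1, c2, ← add_assoc n k 1, add_right_comm n 1 k, poch_succ, pow_succ,
        Nat.factorial_succ]
      push_cast
      field_simp
      ring
    have hsum : (n + 1) * (1 + a / 2 + n) * (1 + a - b + n)
        * ∑ k ∈ Finset.range (n + 1 + 1), f (n + 1) k
        = (1 + a / 2 - b + n) * ∑ k ∈ Finset.range (n + 1), f n k := by
      have h0 : f n (n + 1) = 0 := by simp [hf]
      have h1 : ∑ k ∈ Finset.range (n + 1 + 1), f n k = ∑ k ∈ Finset.range (n + 1), f n k := by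
        rw [Finset.sum_range_succ, h0, add_zero]
      have h2 : g (n + 1 + 1) = 0 := by simp [hg]
      have h3 : g 0 = 0 := by simp [hg]
      rw [← h1, ← sub_eq_zero, Finset.mul_sum, Finset.mul_sum, ← Finset.sum_sub_distrib,
        Finset.sum_congr rfl fun k _ => key k, Finset.sum_range_sub, h2, h3, sub_zero]
    have q1 : 1 + a / 2 + n ≠ 0 := fun h => ha2 n (eq_neg_of_add_eq_zero_left h)
    have q2 : 1 + a - b + n ≠ 0 := fun h => hab n (eq_neg_of_add_eq_zero_left h)
    have q3 := poch_ne_zero hab n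
    have q4 := poch_ne_zero ha2 n
    have hfac : (n.factorial : ℝ) ≠ 0 := by positivity
    have hn1 : (n + 1 : ℝ) ≠ 0 := by positivity
    rw [ih] at hsum
    have hne : (n + 1) * (1 + a / 2 + n) * (1 + a - b + n) ≠ 0 :=
      mul_ne_zero (mul_ne_zero hn1 q1) q2
    rw [← mul_right_inj' hne, hsum, poch_succ, poch_succ, poch_succ, Nat.factorial_succ]
    generalize poch (1 + a / 2) n = A at *
    generalize poch (1 + a / 2 - b) n = B at *
    generalize 1 + a / 2 + (n : ℝ) = y at *
    push_cast
    field_simp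

/-- The general term of the well-poised `₄F₃(a, b, c, d; 1 + a - b, 1 + a - c, 1 + a - d; -1)`. -/
noncomputable def wellPoisedTerm (a b c d : ℝ) (k : ℕ) : ℝ :=
  (poch a k * poch b k * poch c k * poch d k)
    / (poch (1 + a - b) k * poch (1 + a - c) k * poch (1 + a - d) k * (k.factorial : ℝ))
    * (-1) ^ k

theorem summable_wellPoisedTerm {a b c d : ℝ} (hb : ∀ n : ℕ, 1 + a - b ≠ -(n : ℝ))
    (hc : ∀ n : ℕ, 1 + a - c ≠ -(n : ℝ)) (hd : ∀ n : ℕ, 1 + a - d ≠ -(n : ℝ))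
    (h : 0 < 3 + 2 * a - 2 * (b + c + d)) : Summable (wellPoisedTerm a b c d) := by
  have hlim := ((((tendsto_poch_div a).mul (tendsto_poch_div b)).mul (tendsto_poch_div c)).mul
    (tendsto_poch_div d)).div (((tendsto_poch_div (1 + a - b)).mul
    (tendsto_poch_div (1 + a - c))).mul (tendsto_poch_div (1 + a - d)))
    (mul_ne_zero (mul_ne_zero (inv_ne_zero (Gamma_ne_zero hb)) (inv_ne_zero (Gamma_ne_zero hc)))
      (inv_ne_zero (Gamma_ne_zero hd)))
  refine Summable.of_norm (summable_of_tendsto_mul_rpow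
    (p := 1 + (3 + 2 * a - 2 * (b + c + d))) (by linarith) (hlim.norm.congr' ?_))
  filter_upwards [eventually_ge_atTop 1] with k hk
  have hk0 : (0 : ℝ) < k := by exact_mod_cast hk
  have p1 := poch_ne_zero hb k
  have p2 := poch_ne_zero hc k
  have p3 := poch_ne_zero hd k
  have hf : (k.factorial : ℝ) ≠ 0 := by positivity
  have h1 : (k : ℝ) ^ (1 + a - b - 1) * k ^ (1 + a - c - 1) * k ^ (1 + a - d - 1)
      = k ^ (a - 1) * k ^ (b - 1) * k ^ (c - 1) * k ^ (d - 1)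
        * k ^ (1 + (3 + 2 * a - 2 * (b + c + d))) := by
    simp only [← rpow_add hk0]
    ring_nf
  have e1 : (0 : ℝ) < (k : ℝ) ^ (1 + (3 + 2 * a - 2 * (b + c + d))) := by positivity
  have key : poch a k / (k.factorial * (k : ℝ) ^ (a - 1))
        * (poch b k / (k.factorial * (k : ℝ) ^ (b - 1)))
        * (poch c k / (k.factorial * (k : ℝ) ^ (c - 1)))
        * (poch d k / (k.factorial * (k : ℝ) ^ (d - 1)))
        / (poch (1 + a - b) k / (k.factorial * (k : ℝ) ^ (1 + a - b - 1))
          * (poch (1 + a - c) k / (k.factorial * (k : ℝ) ^ (1 + a - c - 1)))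
          * (poch (1 + a - d) k / (k.factorial * (k : ℝ) ^ (1 + a - d - 1))))
      = (poch a k * poch b k * poch c k * poch d k)
        / (poch (1 + a - b) k * poch (1 + a - c) k * poch (1 + a - d) k * (k.factorial : ℝ))
        * k ^ (1 + (3 + 2 * a - 2 * (b + c + d))) := by
    have e2 : (k : ℝ) ^ (a - 1) ≠ 0 := by positivity
    have e3 : (k : ℝ) ^ (b - 1) ≠ 0 := by positivity
    have e4 : (k : ℝ) ^ (c - 1) ≠ 0 := by positivity
    have e5 : (k : ℝ) ^ (d - 1) ≠ 0 := by positivity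
    have e6 : (k : ℝ) ^ (1 + a - b - 1) ≠ 0 := by positivity
    have e7 : (k : ℝ) ^ (1 + a - c - 1) ≠ 0 := by positivity
    have e8 : (k : ℝ) ^ (1 + a - d - 1) ≠ 0 := by positivity
    generalize (k : ℝ) ^ (1 + (3 + 2 * a - 2 * (b + c + d))) = z0 at *
    generalize (k : ℝ) ^ (a - 1) = z1 at *
    generalize (k : ℝ) ^ (b - 1) = z2 at *
    generalize (k : ℝ) ^ (c - 1) = z3 at *
    generalize (k : ℝ) ^ (d - 1) = z4 at *
    generalize (k : ℝ) ^ (1 + a - b - 1) = z5 at *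
    generalize (k : ℝ) ^ (1 + a - c - 1) = z6 at *
    generalize (k : ℝ) ^ (1 + a - d - 1) = z7 at *
    field_simp
    linear_combination (poch a k * poch b k * poch c k * poch d k) * h1
  simp only [Pi.div_apply]
  rw [key, wellPoisedTerm, norm_mul, norm_of_nonneg e1.le, norm_mul, norm_pow, norm_neg, norm_one,
    one_pow, mul_one]

/-- The coefficient of `₂F₁(c + k, d + k; 1 + a + 2k; 1)` in the expansion of the
well-poised `₄F₃`. -/
noncomputable def whippleCoeff (a b c d : ℝ) (k : ℕ) : ℝ :=
  (-1) ^ k * poch a k * poch b k * poch c k * poch d k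
    / (k.factorial * poch (1 + a - b) k * poch (1 + a) (2 * k))

/-- The double series obtained from the well-poised `₄F₃` by Gauss's theorem. -/
noncomputable def whippleTerm (a b c d : ℝ) (p : ℕ × ℕ) : ℝ :=
  whippleCoeff a b c d p.1 * gaussTerm (c + p.1) (d + p.1) (1 + a + (2 * p.1 : ℕ)) p.2

theorem summable_whippleTerm_right {a c d : ℝ} (b : ℝ) (ha : ∀ n : ℕ, 1 + a ≠ -(n : ℝ))
    (h : 0 < 1 + a - c - d) (k : ℕ) : Summable fun m => whippleTerm a b c d (k, m) := by
  have hk : 0 < 1 + a + (2 * k : ℕ) - (c + k) - (d + k) := by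
    push_cast
    linarith
  simp only [whippleTerm]
  exact (summable_gaussTerm (ne_neg_nat_add ha (2 * k)) hk).mul_left _

theorem tsum_whippleTerm_right {a c d : ℝ} (b : ℝ)
    (ha : ∀ n : ℕ, 1 + a ≠ -(n : ℝ)) (hc : ∀ n : ℕ, 1 + a - c ≠ -(n : ℝ))
    (hd : ∀ n : ℕ, 1 + a - d ≠ -(n : ℝ)) (h : 0 < 1 + a - c - d) (k : ℕ) :
    ∑' m, whippleTerm a b c d (k, m)
      = Gamma (1 + a) * Gamma (1 + a - c - d) / (Gamma (1 + a - c) * Gamma (1 + a - d))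
        * wellPoisedTerm a b c d k := by
  have e1 : 1 + a + (2 * k : ℕ) - (c + k) = 1 + a - c + k := by push_cast; ring
  have e2 : 1 + a + (2 * k : ℕ) - (d + k) = 1 + a - d + k := by push_cast; ring
  have e3 : 1 + a - c + k - (d + k) = 1 + a - c - d := by ring
  have hk : 0 < 1 + a + (2 * k : ℕ) - (c + k) - (d + k) := by rwa [e1, e3]
  have hG := tsum_gaussTerm (ne_neg_nat_add ha (2 * k)) hk
  rw [e1, e2, e3, Gamma_add_nat ha, Gamma_add_nat hc, Gamma_add_nat hd] at hG
  have p1 := poch_ne_zero ha (2 * k)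
  simp only [whippleTerm, tsum_mul_left, hG, whippleCoeff, wellPoisedTerm]
  simp only [div_eq_mul_inv, mul_inv]
  linear_combination ((-1) ^ k * poch a k * poch b k * poch c k * poch d k
    * (k.factorial : ℝ)⁻¹ * (poch (1 + a - b) k)⁻¹ * Gamma (1 + a) * Gamma (1 + a - c - d)
    * (poch (1 + a - c) k)⁻¹ * (Gamma (1 + a - c))⁻¹ * (poch (1 + a - d) k)⁻¹
    * (Gamma (1 + a - d))⁻¹) * mul_inv_cancel₀ p1

theorem summable_whippleTerm {a b c d : ℝ} (ha : ∀ n : ℕ, 1 + a ≠ -(n : ℝ))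
    (hb : ∀ n : ℕ, 1 + a - b ≠ -(n : ℝ)) (hc : ∀ n : ℕ, 1 + a - c ≠ -(n : ℝ))
    (hd : ∀ n : ℕ, 1 + a - d ≠ -(n : ℝ)) (h : 0 < 1 + a - c - d)
    (h' : 0 < 3 + 2 * a - 2 * (b + c + d)) : Summable (whippleTerm a b c d) := by
  refine Summable.of_norm ((summable_prod_of_nonneg fun _ => norm_nonneg _).2
    ⟨fun k => (summable_whippleTerm_right b ha h k).norm, ?_⟩)
  refine ((summable_wellPoisedTerm hb hc hd h').mul_left (Gamma (1 + a) * Gamma (1 + a - c - d)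
    / (Gamma (1 + a - c) * Gamma (1 + a - d)))).norm.of_norm_bounded_eventually_nat ?_
  have hcast : ∀ x : ℝ, ∀ᶠ k : ℕ in atTop, 0 < x + k := fun x =>
    (tendsto_atTop_add_const_left _ x tendsto_natCast_atTop_atTop).eventually_gt_atTop 0
  filter_upwards [hcast c, hcast d, hcast (1 + a)] with k hck hdk hak
  have hak' : 0 < 1 + a + (2 * k : ℕ) := by
    have : (0 : ℝ) ≤ k := k.cast_nonneg
    push_cast
    linarith
  have hpos : ∀ m, 0 ≤ gaussTerm (c + k) (d + k) (1 + a + (2 * k : ℕ)) m := fun m => by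
    have := poch_pos hck m
    have := poch_pos hdk m
    have := poch_pos hak' m
    unfold gaussTerm
    positivity
  rw [← tsum_whippleTerm_right b ha hc hd h]
  simp only [whippleTerm, norm_mul, tsum_mul_left]
  simp only [norm_norm, fun m => norm_of_nonneg (hpos m), tsum_nonneg hpos,
    norm_of_nonneg, le_refl]

theorem sum_antidiagonal_whippleTerm {a b : ℝ} (c d : ℝ) (ha : ∀ n : ℕ, 1 + a ≠ -(n : ℝ))
    (ha2 : ∀ n : ℕ, 1 + a / 2 ≠ -(n : ℝ)) (hb : ∀ n : ℕ, 1 + a - b ≠ -(n : ℝ)) (n : ℕ) :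
    ∑ p ∈ Finset.HasAntidiagonal.antidiagonal n, whippleTerm a b c d p
      = poch (1 + a / 2 - b) n * poch c n * poch d n
        / (poch (1 + a / 2) n * poch (1 + a - b) n * n.factorial) := by
  have hterm : ∀ k ∈ Finset.range (n + 1), whippleTerm a b c d (k, n - k)
      = poch c n * poch d n * ((-1) ^ k * poch a k * poch b k * (n.choose k : ℝ)
        / (n.factorial * poch (1 + a - b) k * poch (1 + a) (n + k))) := by
    intro k hk
    obtain ⟨m, rfl⟩ := Nat.exists_eq_add_of_le (Nat.lt_succ_iff.1 (Finset.mem_range.1 hk))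
    have hch : ((k + m).choose k : ℝ) * k.factorial * m.factorial = (k + m).factorial := by
      have := Nat.choose_mul_factorial_mul_factorial (Nat.le_add_right k m)
      rw [Nat.add_sub_cancel_left] at this
      exact_mod_cast this
    have hadd : poch (1 + a) (k + m + k)
        = poch (1 + a) (2 * k) * poch (1 + a + (2 * k : ℕ)) m := by
      rw [← poch_add]
      congr 1
      ring
    have p1 := poch_ne_zero ha (2 * k)
    have p2 := poch_ne_zero (ne_neg_nat_add ha (2 * k)) m
    have p3 := poch_ne_zero hb k
    have f1 : (k.factorial : ℝ) ≠ 0 := by positivity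
    have f2 : (m.factorial : ℝ) ≠ 0 := by positivity
    have f3 : ((k + m).choose k : ℝ) ≠ 0 := by
      exact_mod_cast (Nat.choose_pos (Nat.le_add_right k m)).ne'
    rw [Nat.add_sub_cancel_left, hadd, poch_add c, poch_add d, ← hch]
    simp only [whippleTerm, whippleCoeff, gaussTerm]
    field_simp
  rw [Finset.Nat.sum_antidiagonal_eq_sum_range_succ_mk, Finset.sum_congr rfl hterm,
    ← Finset.mul_sum, sum_choose_poch_eq hb ha2 ha]
  ring

/-- Whipple's reduction formula for a well-poised `₄F₃(−1)`. -/
theorem whipple_wellPoised_4F3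
    (r1 r2 r3 r4 : ℝ)
    (h2 : ∀ n : ℕ, 1 + r1 - r2 ≠ -(n : ℝ))
    (h3 : ∀ n : ℕ, 1 + r1 - r3 ≠ -(n : ℝ))
    (h4 : ∀ n : ℕ, 1 + r1 - r4 ≠ -(n : ℝ))
    (h5 : ∀ n : ℕ, 1 + r1 / 2 ≠ -(n : ℝ))
    (h6 : ∀ n : ℕ, 1 + r1 ≠ -(n : ℝ))
    (hconv1 : 0 < 1 + r1 - r3 - r4)
    (hconv2 : 0 < 3 + 2 * r1 - 2 * (r2 + r3 + r4)) :
    F43 r1 r2 r3 r4 (1 + r1 - r2) (1 + r1 - r3) (1 + r1 - r4) (-1)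
      = Gamma (1 + r1 - r3) * Gamma (1 + r1 - r4)
          / (Gamma (1 + r1) * Gamma ((1 + r1 - r4) - r3))
        * F32 (1 + r1 / 2 - r2) r3 r4 (1 + r1 / 2) (1 + r1 - r2) 1 := by
  have hsum := summable_whippleTerm h6 h2 h3 h4 hconv1 hconv2
  have e1 := hsum.tsum_prod
  have hsigma := (Finset.HasAntidiagonal.sigmaAntidiagonalEquivProd.summable_iff.2 hsum).tsum_sigma
  simp only [Function.comp_apply] at hsigma
  rw [← Finset.HasAntidiagonal.sigmaAntidiagonalEquivProd.tsum_eq, hsigma] at e1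
  have e2 : ∀ n : ℕ, ∑' p : Finset.HasAntidiagonal.antidiagonal n,
      whippleTerm r1 r2 r3 r4 (Finset.HasAntidiagonal.sigmaAntidiagonalEquivProd ⟨n, p⟩)
      = ∑ p ∈ Finset.HasAntidiagonal.antidiagonal n, whippleTerm r1 r2 r3 r4 p := fun n => by
    rw [tsum_fintype]
    exact Finset.sum_coe_sort (Finset.HasAntidiagonal.antidiagonal n) (whippleTerm r1 r2 r3 r4)
  simp only [e2, sum_antidiagonal_whippleTerm r3 r4 h6 h5 h2,
    tsum_whippleTerm_right r2 h6 h3 h4 hconv1, tsum_mul_left] at e1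
  have e3 : 1 + r1 - r4 - r3 = 1 + r1 - r3 - r4 := by ring
  have g1 := Gamma_ne_zero h6
  have g2 := Gamma_ne_zero h3
  have g3 := Gamma_ne_zero h4
  have g4 := (Gamma_pos_of_pos hconv1).ne'
  simp only [F43, F32, one_pow, mul_one]
  rw [e1, e3]
  simp only [wellPoisedTerm]
  field_simp
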